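/- Let G₁ and G₂ be two properly coloured non-crossing geometric graphs in the plane, each having at least one edge, such that the convex hulls of their vertex sets are disjoint and the union of their vertex sets is not contained in a single line. Then there exist vertices v₁ of G₁ and v₂ of G₂ with different colours such that the straight line segment v₁v₂ intersects no vertex or edge of G₁ ∪ G₂ except at its endpoints; consequently G₁ ∪ G₂ together with the edge v₁v₂ is a properly coloured non-crossing geometric graph. -/

import Mathlib

/-- A geometric graph: a finite set of points of the plane together with a symmetric,
irreflexive adjacency relation supported on those points; edges are drawn as straight
line segments. -/
structure GeomGraph where
  verts : Finset (ℝ × ℝ)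
  Adj : (ℝ × ℝ) → (ℝ × ℝ) → Prop
  symm : ∀ x y, Adj x y → Adj y x
  loopless : ∀ x, ¬ Adj x x
  mem_verts_of_adj : ∀ x y, Adj x y → x ∈ verts

/-- A colouring `c` of the points of the plane is proper for a geometric graph if
adjacent vertices get different colours. -/
def ProperlyColoured {C : Type*} (G : GeomGraph) (c : (ℝ × ℝ) → C) : Prop :=
  ∀ x y, G.Adj x y → c x ≠ c y

/-- A geometric graph is non-crossing if no edge passes through a vertex other than its
endpoints, and any two distinct edges intersect only at common endpoints. -/
def GeomNonCrossing (G : GeomGraph) : Prop :=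
  (∀ x y, G.Adj x y → ∀ v ∈ G.verts, v ∈ segment ℝ x y → v = x ∨ v = y) ∧
  (∀ x y z w, G.Adj x y → G.Adj z w → s(x, y) ≠ s(z, w) →
    ∀ p ∈ segment ℝ x y, p ∈ segment ℝ z w → (p = x ∨ p = y) ∧ (p = z ∨ p = w))

namespace GeomGraph

/-- An affine function `side` on the plane together with an orientation of the plane. -/
structure Frame where
  u : ℝ
  v : ℝ
  w : ℝ
  e : ℝ
  e_ne : e ≠ 0
  norm_pos : 0 < u ^ 2 + v ^ 2

namespace Frame

variable (F : Frame)

/-- The value of the affine function of the frame. -/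
def side (p : ℝ × ℝ) : ℝ := F.u * p.1 + F.v * p.2 + F.w

/-- The oriented area of the parallelogram spanned by a triangle. -/
def area (p q r : ℝ × ℝ) : ℝ :=
  F.e * ((q.1 - p.1) * (r.2 - p.2) - (q.2 - p.2) * (r.1 - p.1))

/-- The position at which the line through `x` and `y` crosses the zero set of `side`. -/
noncomputable def height (x y : ℝ × ℝ) : ℝ :=
  F.e * (F.side y * (F.u * x.2 - F.v * x.1) - F.side x * (F.u * y.2 - F.v * y.1)) /
    (F.side y - F.side x)

/-- The frame with both the affine function and the orientation reversed. -/
def swap : Frame where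
  u := -F.u
  v := -F.v
  w := -F.w
  e := -F.e
  e_ne := neg_ne_zero.2 F.e_ne
  norm_pos := by simpa using F.norm_pos

theorem swap_swap : F.swap.swap = F := by
  cases F; simp [swap]

theorem side_swap (p : ℝ × ℝ) : F.swap.side p = -F.side p := by
  simp only [side, swap]; ring

theorem area_swap (p q r : ℝ × ℝ) : F.swap.area q p r = F.area p q r := by
  simp only [area, swap]; ring

theorem height_swap (x y : ℝ × ℝ) : F.swap.height y x = F.height x y := by
  simp only [height, side_swap]
  simp only [swap]
  congr 1 <;> ring

theorem side_comb {l m : ℝ} (h : l + m = 1) (p q : ℝ × ℝ) :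
    F.side (l • p + m • q) = l * F.side p + m * F.side q := by
  obtain rfl : m = 1 - l := by linarith
  simp only [side, Prod.fst_add, Prod.snd_add, Prod.smul_fst, Prod.smul_snd, smul_eq_mul]
  ring

theorem area_comb {l m : ℝ} (h : l + m = 1) (a b p q : ℝ × ℝ) :
    F.area a b (l • p + m • q) = l * F.area a b p + m * F.area a b q := by
  obtain rfl : m = 1 - l := by linarith
  simp only [area, Prod.fst_add, Prod.snd_add, Prod.smul_fst, Prod.smul_snd, smul_eq_mul]
  ring

@[simp] theorem area_left (p q : ℝ × ℝ) : F.area p q p = 0 := by simp only [area]; ring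

@[simp] theorem area_right (p q : ℝ × ℝ) : F.area p q q = 0 := by simp only [area]; ring

theorem area_rotate (p q r : ℝ × ℝ) : F.area q r p = F.area p q r := by
  simp only [area]; ring

theorem area_flip (p q r : ℝ × ℝ) : F.area p r q = -F.area p q r := by
  simp only [area]; ring

theorem neg_area (p q r : ℝ × ℝ) : -F.area p q r = F.area q p r := by
  simp only [area]; ring

theorem height_sub {x y a b : ℝ × ℝ} (hxy : F.side x < F.side y) (hab : F.side a < F.side b) :
    (F.u ^ 2 + F.v ^ 2) * (F.side b * F.area x y a - F.side a * F.area x y b) =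
      (F.side b - F.side a) * (F.side y - F.side x) * (F.height a b - F.height x y) := by
  have h1 : F.side y - F.side x ≠ 0 := by linarith
  have h2 : F.side b - F.side a ≠ 0 := by linarith
  simp only [height]
  field_simp
  simp only [area, side]
  ring

theorem area_mul_side (x y s n : ℝ × ℝ) :
    (F.side y - F.side x) * F.area x s n =
      (F.side s - F.side x) * F.area x y n - (F.side n - F.side x) * F.area x y s := by
  simp only [area, side]; ring

/-- Two points with different values of `side` on a line span the same oriented line. -/
theorem area_change_base {x y p q : ℝ × ℝ} (hp : F.area y x p = 0) (hq : F.area y x q = 0)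
    (r : ℝ × ℝ) :
    (F.side y - F.side x) * F.area q p r = (F.side q - F.side p) * F.area y x r := by
  have key : (F.side y - F.side x) * F.area q p r - (F.side q - F.side p) * F.area y x r =
      (F.side r - F.side q) * F.area y x p - (F.side r - F.side p) * F.area y x q := by
    simp only [area, side]; ring
  rw [hp, hq] at key
  linarith

theorem mem_segment_of_area_eq_zero {a b g : ℝ × ℝ} (h : F.area a b g = 0)
    (hab : F.side a < F.side b) (hag : F.side a ≤ F.side g) (hgb : F.side g ≤ F.side b) :
    g ∈ segment ℝ a b := by
  have hd : 0 < F.side b - F.side a := by linarith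
  have h0 : (b.1 - a.1) * (g.2 - a.2) - (b.2 - a.2) * (g.1 - a.1) = 0 :=
    (mul_eq_zero.1 h).resolve_left F.e_ne
  refine ⟨(F.side b - F.side g) / (F.side b - F.side a),
    (F.side g - F.side a) / (F.side b - F.side a), div_nonneg (by linarith) hd.le,
    div_nonneg (by linarith) hd.le, ?_, ?_⟩
  · field_simp; ring
  · ext
    · simp only [Prod.fst_add, Prod.smul_fst, smul_eq_mul]
      field_simp
      simp only [side]
      linear_combination F.v * h0
    · simp only [Prod.snd_add, Prod.smul_snd, smul_eq_mul]
      field_simp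
      simp only [side]
      linear_combination -F.u * h0

/-- A point of a nondegenerate triangle that lies on the line through two of the vertices
lies on the corresponding side. -/
theorem mem_segment_of_barycentric {x y z p : ℝ × ℝ} (h : 0 < F.area x y z)
    (hz : F.area x y p = 0) (hx : 0 ≤ F.area y z p) (hy : 0 ≤ F.area z x p) :
    p ∈ segment ℝ x y := by
  have hsum : F.area y z p + F.area z x p = F.area x y z := by
    have : F.area x y p + F.area y z p + F.area z x p = F.area x y z := by
      simp only [area]; ring
    linarith
  have h0 : (y.1 - x.1) * (p.2 - x.2) - (y.2 - x.2) * (p.1 - x.1) = 0 :=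
    (mul_eq_zero.1 hz).resolve_left F.e_ne
  refine ⟨F.area y z p / F.area x y z, F.area z x p / F.area x y z, by positivity,
    by positivity, ?_, ?_⟩
  · rw [← add_div, hsum, div_self h.ne']
  · ext
    · simp only [Prod.fst_add, Prod.smul_fst, smul_eq_mul]
      field_simp
      simp only [area]
      linear_combination -F.e * z.1 * h0
    · simp only [Prod.snd_add, Prod.smul_snd, smul_eq_mul]
      field_simp
      simp only [area]
      linear_combination -F.e * z.2 * h0

/-- Among the segments joining two finite sets on different sides, one has both sets
weakly below its line, and no point of these sets in its interior. -/
theorem exists_bridge (S T : Finset (ℝ × ℝ)) (hS : S.Nonempty) (hT : T.Nonempty)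
    (hSs : ∀ p ∈ S, F.side p < 0) (hTs : ∀ p ∈ T, 0 < F.side p) :
    ∃ a ∈ S, ∃ b ∈ T, (∀ g, g ∈ S ∨ g ∈ T → F.area a b g ≤ 0) ∧
      ∀ g, g ∈ S ∨ g ∈ T → F.area a b g = 0 → F.side g ≤ F.side a ∨ F.side b ≤ F.side g := by
  obtain ⟨⟨a, b⟩, hab, hmax⟩ := Finset.exists_max_image (S ×ˢ T)
    (fun p => toLex (F.height p.1 p.2, F.side p.1 - F.side p.2)) (hS.product hT)
  rw [Finset.mem_product] at hab
  have hmax' : ∀ p ∈ S, ∀ q ∈ T, F.height p q < F.height a b ∨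
      F.height p q = F.height a b ∧ F.side p - F.side q ≤ F.side a - F.side b := by
    intro p hp q hq
    have := hmax (p, q) (Finset.mem_product.2 ⟨hp, hq⟩)
    simpa [Prod.Lex.toLex_le_toLex] using this
  have ha := hSs a hab.1
  have hb := hTs b hab.2
  have hn := F.norm_pos
  refine ⟨a, hab.1, b, hab.2, ?_, ?_⟩
  · rintro g (hg | hg)
    · have hgs := hSs g hg
      have key := F.height_sub (x := a) (y := b) (a := g) (b := b) (by linarith) (by linarith)
      rw [area_right, mul_zero, sub_zero] at key
      have hle : F.height g b - F.height a b ≤ 0 := by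
        rcases hmax' g hg b hab.2 with h | h <;> linarith
      have h1 : 0 < (F.side b - F.side g) * (F.side b - F.side a) :=
        mul_pos (by linarith) (by linarith)
      by_contra hcon
      push Not at hcon
      have h2 : 0 < (F.u ^ 2 + F.v ^ 2) * (F.side b * F.area a b g) := by positivity
      nlinarith
    · have hgs := hTs g hg
      have key := F.height_sub (x := a) (y := b) (a := a) (b := g) (by linarith) (by linarith)
      rw [area_left, mul_zero, zero_sub] at key
      have hle : F.height a g - F.height a b ≤ 0 := by
        rcases hmax' a hab.1 g hg with h | h <;> linarith
      have h1 : 0 < (F.side g - F.side a) * (F.side b - F.side a) :=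
        mul_pos (by linarith) (by linarith)
      by_contra hcon
      push Not at hcon
      have h2 : 0 < (F.u ^ 2 + F.v ^ 2) * (-(F.side a * F.area a b g)) :=
        mul_pos hn (by nlinarith)
      nlinarith
  · rintro g (hg | hg) h0
    · have hgs := hSs g hg
      have key := F.height_sub (x := a) (y := b) (a := g) (b := b) (by linarith) (by linarith)
      rw [area_right, h0] at key
      have h1 : 0 < (F.side b - F.side g) * (F.side b - F.side a) :=
        mul_pos (by linarith) (by linarith)
      have : F.height g b - F.height a b = 0 := by
        have : (F.side b - F.side g) * (F.side b - F.side a) *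
          (F.height g b - F.height a b) = 0 := by linarith
        exact (mul_eq_zero.1 this).resolve_left h1.ne'
      rcases hmax' g hg b hab.2 with h | h
      · linarith
      · left; linarith [h.2]
    · have hgs := hTs g hg
      have key := F.height_sub (x := a) (y := b) (a := a) (b := g) (by linarith) (by linarith)
      rw [area_left, h0] at key
      have h1 : 0 < (F.side g - F.side a) * (F.side b - F.side a) :=
        mul_pos (by linarith) (by linarith)
      have : F.height a g - F.height a b = 0 := by
        have : (F.side g - F.side a) * (F.side b - F.side a) *
          (F.height a g - F.height a b) = 0 := by linarith
        exact (mul_eq_zero.1 this).resolve_left h1.ne'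
      rcases hmax' a hab.1 g hg with h | h
      · linarith
      · right; linarith [h.2]

/-- If `Y` is weakly below the line through `a` and `b`, and these two points are above the
line through `X` and `Y`, then points of the latter line on the left of `b` are above the
former line. -/
theorem area_pos_of_axis {X Y a b w : ℝ × ℝ} (hXY : F.side X < F.side Y)
    (hab : F.side a < F.side b) (haY : F.side a < F.side Y) (ha : 0 < F.area Y X a)
    (hb : 0 ≤ F.area Y X b) (hY : F.area a b Y ≤ 0) (hw : F.area Y X w = 0)
    (hwb : F.side w < F.side b) : 0 < F.area a b w := by
  set D := F.e * ((b.1 - a.1) * (Y.2 - X.2) - (b.2 - a.2) * (Y.1 - X.1)) with hD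
  have h1 : (F.side Y - F.side X) * F.area a b Y =
      (F.side b - F.side a) * F.area Y X a + (F.side Y - F.side a) * D := by
    simp only [area, side, hD]; ring
  have h2 : (F.side Y - F.side X) * F.area a b w =
      (F.side b - F.side a) * F.area Y X b + (F.side w - F.side b) * D := by
    have : (F.side Y - F.side X) * F.area a b w =
      (F.side b - F.side a) * F.area Y X b + (F.side w - F.side b) * D
        - (F.side b - F.side a) * F.area Y X w := by
      simp only [area, side, hD]; ring
    rw [this, hw]; ring
  have h3 : 0 < (F.side b - F.side a) * F.area Y X a := mul_pos (by linarith) ha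
  have hDneg : D < 0 := by
    by_contra hcon
    push Not at hcon
    have := mul_nonneg (sub_nonneg.2 haY.le) hcon
    have := mul_nonpos_of_nonneg_of_nonpos (sub_nonneg.2 hXY.le) hY
    linarith
  have h4 := mul_pos_of_neg_of_neg (sub_neg.2 hwb) hDneg
  have h5 := mul_nonneg (sub_nonneg.2 hab.le) hb
  have h6 : 0 < (F.side Y - F.side X) * F.area a b w := by linarith
  exact (mul_pos_iff_of_pos_left (sub_pos.2 hXY)).1 h6

theorem area_barycentric (X Y s a b w : ℝ × ℝ) :
    F.area Y X s * F.area a b w = F.area s Y w * F.area a b X + F.area X s w * F.area a b Y +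
      F.area Y X w * F.area a b s := by
  simp only [area]; ring

end Frame

theorem exists_comb_of_mem_segment {x y p : ℝ × ℝ} (hp : p ∈ segment ℝ x y) (hx : p ≠ x)
    (hy : p ≠ y) : ∃ l m : ℝ, 0 < l ∧ 0 < m ∧ l + m = 1 ∧ l • x + m • y = p := by
  obtain ⟨l, m, hl, hm, hlm, rfl⟩ := hp
  refine ⟨l, m, hl.lt_of_ne' ?_, hm.lt_of_ne' ?_, hlm, rfl⟩
  · rintro rfl
    obtain rfl : m = 1 := by linarith
    simp at hy
  · rintro rfl
    obtain rfl : l = 1 := by linarith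
    simp at hx

/-- A path from a point with two positive coordinates to a point with a negative one
leaves the positive quadrant. -/
theorem exists_exit {a b a' b' : ℝ} (ha : 0 < a) (hb : 0 < b) (h : a' < 0 ∨ b' < 0) :
    ∃ t : ℝ, 0 < t ∧ t < 1 ∧ 0 ≤ (1 - t) * a + t * a' ∧ 0 ≤ (1 - t) * b + t * b' ∧
      ((1 - t) * a + t * a' = 0 ∨ (1 - t) * b + t * b' = 0) := by
  have main : ∀ {a b a' b' : ℝ}, 0 < a → 0 < b → a' < 0 → a' * b ≤ b' * a →
      ∃ t : ℝ, 0 < t ∧ t < 1 ∧ (1 - t) * a + t * a' = 0 ∧ 0 ≤ (1 - t) * b + t * b' := by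
    intro a b a' b' ha hb ha' hle
    have hd : 0 < a - a' := by linarith
    refine ⟨a / (a - a'), by positivity, by rw [div_lt_one hd]; linarith, ?_, ?_⟩
    · field_simp; ring
    · have : (1 - a / (a - a')) * b + a / (a - a') * b' = (b' * a - a' * b) / (a - a') := by
        field_simp; ring
      rw [this]
      exact div_nonneg (by linarith) hd.le
  rcases le_total (a' * b) (b' * a) with hle | hle
  · have ha' : a' < 0 := by
      rcases h with h | h
      · exact h
      · by_contra hcon
        push Not at hcon
        nlinarith
    obtain ⟨t, h0, h1, h2, h3⟩ := main ha hb ha' hle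
    exact ⟨t, h0, h1, h2.ge, h3, Or.inl h2⟩
  · have hb' : b' < 0 := by
      rcases h with h | h
      · by_contra hcon
        push Not at hcon
        nlinarith
      · exact h
    obtain ⟨t, h0, h1, h2, h3⟩ := main hb ha hb' hle
    exact ⟨t, h0, h1, h3, h2.ge, Or.inr h2⟩

variable (F : Frame) (G : GeomGraph)

/-- The segment joining `x` and `y` meets the graph only at its endpoints. -/
def Sees (x y : ℝ × ℝ) : Prop :=
  (∀ z ∈ G.verts, z ∈ segment ℝ x y → z = x ∨ z = y) ∧
  ∀ s t, G.Adj s t → ∀ p ∈ segment ℝ s t, p ∈ segment ℝ x y → p = x ∨ p = y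

/-- The zero set of `side` separates the non-crossing graph `G` into two parts. -/
structure Separates : Prop where
  side_ne : ∀ p ∈ G.verts, F.side p ≠ 0
  side_mul : ∀ p q, G.Adj p q → 0 < F.side p * F.side q
  nonCrossing : GeomNonCrossing G

/-- No edge has a part in `P`, above the line through `X` and `Y` and weakly above the line
through `a` and `b`, from which it goes up to an endpoint above the latter line. -/
def Clear (X Y : ℝ × ℝ) (P : ℝ × ℝ → Prop) (a b : ℝ × ℝ) : Prop :=
  ∀ s t, G.Adj s t → ∀ p ∈ segment ℝ s t, P p → 0 < F.area Y X p → 0 ≤ F.area a b p →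
    F.area a b s ≤ 0

/-- The set `P` is weakly star-shaped from the points of `K`. -/
structure IsRegion (K P : ℝ × ℝ → Prop) : Prop where
  sub : ∀ w, P w → K w
  star : ∀ u w, K u → P w → ∀ l m : ℝ, 0 ≤ l → 0 < m → l + m = 1 → P (l • u + m • w)
  right : ∀ g, K g → 0 < F.side g → P g

/-- The segment `ab` is an upper bridge of the part of the graph in the region `K` above the
line through `X` and `Y`. -/
structure IsBridge (X Y : ℝ × ℝ) (K P : ℝ × ℝ → Prop) (a b : ℝ × ℝ) : Prop where
  mem_left : a ∈ G.verts
  side_left : F.side a < 0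
  region_left : K a
  area_left : 0 < F.area Y X a
  mem_right : b ∈ G.verts
  side_right : 0 < F.side b
  right : b = Y ∨ K b ∧ 0 < F.area Y X b
  below : ∀ g ∈ G.verts, K g → 0 < F.area Y X g → F.area a b g ≤ 0
  below_axis : F.area a b Y ≤ 0
  clear : Clear F G X Y P a b
  sees : Sees G a b

variable {F G}

theorem Sees.symm {x y : ℝ × ℝ} (h : Sees G x y) : Sees G y x := by
  refine ⟨fun z hz hzs => ?_, fun s t hst p hp hps => ?_⟩
  · rw [segment_symm] at hzs
    exact (h.1 z hz hzs).symm
  · rw [segment_symm ℝ y x] at hps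
    exact (h.2 s t hst p hp hps).symm

theorem Separates.swap (h : Separates F G) : Separates F.swap G where
  side_ne p hp := by rw [F.side_swap]; exact neg_ne_zero.2 (h.side_ne p hp)
  side_mul p q hpq := by
    rw [F.side_swap, F.side_swap, neg_mul_neg]; exact h.side_mul p q hpq
  nonCrossing := h.nonCrossing

theorem mem_right_of_adj {x y : ℝ × ℝ} (h : G.Adj x y) : y ∈ G.verts :=
  G.mem_verts_of_adj y x (G.symm x y h)

theorem Separates.side_neg (h : Separates F G) {p q : ℝ × ℝ} (hpq : G.Adj p q)
    (hp : F.side p < 0) : F.side q < 0 := by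
  by_contra hc
  nlinarith [h.side_mul p q hpq]

theorem Separates.side_pos (h : Separates F G) {p q : ℝ × ℝ} (hpq : G.Adj p q)
    (hp : 0 < F.side p) : 0 < F.side q := by
  by_contra hc
  nlinarith [h.side_mul p q hpq]

/-- Points weakly above the bridge see each other. -/
theorem sees_of_clear {X Y a b u w : ℝ × ℝ} {K P : ℝ × ℝ → Prop} (hR : IsRegion F K P)
    (hcl : Clear F G X Y P a b)
    (hbelow : ∀ g ∈ G.verts, K g → 0 < F.area Y X g → F.area a b g ≤ 0)
    (hu : K u) (hw : P w) (hEu : 0 ≤ F.area a b u) (hEw : 0 ≤ F.area a b w)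
    (hE : 0 < F.area a b u + F.area a b w) (hAu : 0 ≤ F.area Y X u) (hAw : 0 ≤ F.area Y X w)
    (hA : 0 < F.area Y X u + F.area Y X w) : Sees G u w := by
  have key : ∀ p ∈ segment ℝ u w, p ≠ u → p ≠ w →
      P p ∧ 0 < F.area Y X p ∧ 0 < F.area a b p := by
    intro p hp hpu hpw
    obtain ⟨l, m, hl, hm, hlm, rfl⟩ := exists_comb_of_mem_segment hp hpu hpw
    refine ⟨hR.star u w hu hw l m hl.le hm hlm, ?_, ?_⟩
    · rw [F.area_comb hlm]
      rcases hAu.lt_or_eq with h | h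
      · positivity
      · have : 0 < F.area Y X w := by linarith
        positivity
    · rw [F.area_comb hlm]
      rcases hEu.lt_or_eq with h | h
      · positivity
      · have : 0 < F.area a b w := by linarith
        positivity
  constructor
  · intro z hz hzs
    by_contra hcon
    push Not at hcon
    obtain ⟨h1, h2, h3⟩ := key z hzs hcon.1 hcon.2
    linarith [hbelow z hz (hR.sub z h1) h2]
  · intro s t hst p hp hps
    by_contra hcon
    push Not at hcon
    obtain ⟨h1, h2, h3⟩ := key p hps hcon.1 hcon.2
    have hs := hcl s t hst p hp h1 h2 h3.le
    have ht := hcl t s (G.symm _ _ hst) p (by rwa [segment_symm]) h1 h2 h3.le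
    obtain ⟨l, m, hl, hm, hlm, rfl⟩ := hp
    rw [F.area_comb hlm] at h3
    nlinarith

/-- A segment across the zero set of `side` is free if it does not contain vertices and is
weakly above the edges meeting it. -/
theorem sees_of_below (hS : Separates F G) {a b : ℝ × ℝ} {Q : ℝ × ℝ → Prop}
    (has : F.side a < 0) (hbs : 0 < F.side b)
    (hQ : ∀ p ∈ segment ℝ a b, p ≠ a → p ≠ b → Q p)
    (hgap : ∀ z ∈ G.verts, Q z → F.area a b z = 0 → F.side z ≤ F.side a ∨ F.side b ≤ F.side z)
    (hcl : ∀ s t, G.Adj s t → ∀ p ∈ segment ℝ s t, Q p → F.area a b p = 0 →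
      F.area a b s ≤ 0) : Sees G a b := by
  have hab : F.side a < F.side b := by linarith
  have key : ∀ p ∈ segment ℝ a b, p ≠ a → p ≠ b →
      F.area a b p = 0 ∧ F.side a < F.side p ∧ F.side p < F.side b := by
    intro p hp hpa hpb
    obtain ⟨l, m, hl, hm, hlm, rfl⟩ := exists_comb_of_mem_segment hp hpa hpb
    obtain rfl : l = 1 - m := by linarith
    refine ⟨?_, ?_, ?_⟩
    · rw [F.area_comb hlm]; simp
    · rw [F.side_comb hlm]; nlinarith
    · rw [F.side_comb hlm]; nlinarith
  have hvert : ∀ z ∈ G.verts, z ∈ segment ℝ a b → z = a ∨ z = b := by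
    intro z hz hzs
    by_contra hcon
    push Not at hcon
    obtain ⟨h3, h4, h5⟩ := key z hzs hcon.1 hcon.2
    rcases hgap z hz (hQ z hzs hcon.1 hcon.2) h3 with h | h <;> linarith
  refine ⟨hvert, ?_⟩
  intro s t hst p hp hps
  by_contra hcon
  push Not at hcon
  have h1 := hQ p hps hcon.1 hcon.2
  obtain ⟨h3, h4, h5⟩ := key p hps hcon.1 hcon.2
  have hs := hcl s t hst p hp h1 h3
  have ht := hcl t s (G.symm _ _ hst) p (by rwa [segment_symm]) h1 h3
  have hsV := G.mem_verts_of_adj s t hst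
  have htV := mem_right_of_adj hst
  have hps' : p ≠ s := by
    rintro rfl; exact absurd (hvert p hsV hps) (by tauto)
  have hpt' : p ≠ t := by
    rintro rfl; exact absurd (hvert p htV hps) (by tauto)
  obtain ⟨l, m, hl, hm, hlm, rfl⟩ := exists_comb_of_mem_segment hp hps' hpt'
  rw [F.area_comb hlm] at h3
  have hs0 : F.area a b s = 0 := by nlinarith
  have ht0 : F.area a b t = 0 := by nlinarith
  obtain rfl : l = 1 - m := by linarith
  rw [F.side_comb hlm] at h4 h5
  have hout : ∀ z ∈ G.verts, F.area a b z = 0 → F.side z ≤ F.side a ∨ F.side b ≤ F.side z := by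
    intro z hz hz0
    by_contra hc
    push Not at hc
    rcases hvert z hz (F.mem_segment_of_area_eq_zero hz0 hab hc.1.le hc.2.le) with rfl | rfl
    · exact hc.1.false
    · exact hc.2.false
  rcases (hS.side_ne s hsV).lt_or_gt with h | h
  · have h' := hS.side_neg hst h
    rcases hout s hsV hs0 with h6 | h6
    · rcases hout t htV ht0 with h7 | h7
      · nlinarith
      · linarith
    · linarith
  · have h' := hS.side_pos hst h
    rcases hout s hsV hs0 with h6 | h6
    · linarith
    · rcases hout t htV ht0 with h7 | h7
      · linarith
      · nlinarith

/-- A region with a vertex on the left contains an upper bridge. -/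
theorem exists_isBridge (hS : Separates F G) {X Y : ℝ × ℝ} {K P : ℝ × ℝ → Prop}
    (hR : IsRegion F K P) (hYV : Y ∈ G.verts) (hY : 0 < F.side Y) (hYP : P Y)
    (hne : ∃ g ∈ G.verts, F.side g < 0 ∧ K g ∧ 0 < F.area Y X g)
    (hcl : ∀ a b, F.side a < 0 → 0 < F.area Y X a → 0 < F.side b → 0 ≤ F.area Y X b →
      (∀ g ∈ G.verts, K g → 0 < F.area Y X g → F.area a b g ≤ 0) → F.area a b Y ≤ 0 →
      Clear F G X Y P a b) :
    ∃ a b, IsBridge F G X Y K P a b := by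
  classical
  set S := G.verts.filter fun g => F.side g < 0 ∧ K g ∧ 0 < F.area Y X g with hSdef
  set T := G.verts.filter fun g => 0 < F.side g ∧ (g = Y ∨ K g ∧ 0 < F.area Y X g) with hTdef
  obtain ⟨a, ha, b, hb, hle, hgap⟩ := F.exists_bridge S T
    (by obtain ⟨g, hg, h⟩ := hne; exact ⟨g, by simp [hSdef, hg, h]⟩)
    ⟨Y, by simp [hTdef, hYV, hY]⟩ (by simp +contextual [hSdef]) (by simp +contextual [hTdef])
  have hmem : ∀ g ∈ G.verts, K g → 0 < F.area Y X g → g ∈ S ∨ g ∈ T := by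
    intro g hg hK hA
    rcases (hS.side_ne g hg).lt_or_gt with h | h
    · left; simp [hSdef, hg, h, hK, hA]
    · right; simp [hTdef, hg, h, hK, hA]
  have hYT : Y ∈ S ∨ Y ∈ T := Or.inr (by simp [hTdef, hYV, hY])
  simp only [hSdef, hTdef, Finset.mem_filter] at ha hb
  obtain ⟨haV, has, haK, haA⟩ := ha
  obtain ⟨hbV, hbs, hbr⟩ := hb
  have hbP : P b := by
    rcases hbr with rfl | h
    · exact hYP
    · exact hR.right b h.1 hbs
  have hbA : 0 ≤ F.area Y X b := by
    rcases hbr with rfl | h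
    · simp
    · exact h.2.le
  have hbelow : ∀ g ∈ G.verts, K g → 0 < F.area Y X g → F.area a b g ≤ 0 :=
    fun g hg hK hA => hle g (hmem g hg hK hA)
  have hclear := hcl a b has haA hbs hbA hbelow (hle Y hYT)
  refine ⟨a, b, haV, has, haK, haA, hbV, hbs, hbr, hbelow, hle Y hYT, hclear,
    sees_of_below hS (Q := fun p => P p ∧ 0 < F.area Y X p) has hbs ?_ ?_ ?_⟩
  · intro p hp hpa hpb
    obtain ⟨l, m, hl, hm, hlm, rfl⟩ := exists_comb_of_mem_segment hp hpa hpb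
    refine ⟨hR.star a b haK hbP _ m hl.le hm hlm, ?_⟩
    rw [F.area_comb hlm]; positivity
  · exact fun z hz hzQ h0 => hgap z (hmem z hz (hR.sub z hzQ.1) hzQ.2) h0
  · exact fun s t hst p hp hpQ h0 => hclear s t hst p hp hpQ.1 hpQ.2 h0.ge

variable (F G)

/-- The closed triangle with vertices `X`, `s` and `Y`. -/
def InWedge (X Y s w : ℝ × ℝ) : Prop :=
  0 ≤ F.area Y X w ∧ 0 ≤ F.area X s w ∧ 0 ≤ F.area s Y w

/-- The edge from `X` to `s` is the one closest to the segment `XY` above it, and edges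
meeting the interior of this segment lie on its line. -/
structure IsWedge (X Y s : ℝ × ℝ) : Prop where
  adj : G.Adj X s
  area_pos : 0 < F.area Y X s
  extremal : ∀ n, G.Adj X n → 0 < F.area Y X n → F.area X s n ≤ 0
  axis : ∀ s t, G.Adj s t → ∀ p ∈ segment ℝ s t, p ∈ segment ℝ X Y →
    p = X ∨ p = Y ∨ F.area Y X s = 0 ∧ F.area Y X t = 0
  side_left : F.side X < 0
  mem_right : Y ∈ G.verts
  side_right : 0 < F.side Y

variable {F G}

theorem mem_segment_of_inWedge_of_axis {X Y s p : ℝ × ℝ} (hs : 0 < F.area Y X s)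
    (hp : InWedge F X Y s p) (h0 : F.area Y X p = 0) : p ∈ segment ℝ X Y := by
  rw [segment_symm]
  exact F.mem_segment_of_barycentric hs h0 hp.2.1 hp.2.2

theorem mem_segment_of_inWedge_of_edge {X Y s p : ℝ × ℝ} (hs : 0 < F.area Y X s)
    (hp : InWedge F X Y s p) (h0 : F.area X s p = 0) : p ∈ segment ℝ X s :=
  F.mem_segment_of_barycentric (by rwa [F.area_rotate]) h0 hp.2.2 hp.1

theorem exists_isWedge {X Y n : ℝ × ℝ} (hn : G.Adj X n)
    (hA : 0 < F.area Y X n) (hX : F.side X < 0) (hYV : Y ∈ G.verts) (hY : 0 < F.side Y)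
    (haxis : ∀ s t, G.Adj s t → ∀ p ∈ segment ℝ s t, p ∈ segment ℝ X Y →
      p = X ∨ p = Y ∨ F.area Y X s = 0 ∧ F.area Y X t = 0) :
    ∃ s, IsWedge F G X Y s := by
  classical
  obtain ⟨s, hs, hmax⟩ := Finset.exists_max_image
    (G.verts.filter fun n => G.Adj X n ∧ 0 < F.area Y X n)
    (fun n => (F.side n - F.side X) / F.area Y X n)
    ⟨n, by simp [mem_right_of_adj hn, hn, hA]⟩
  simp only [Finset.mem_filter] at hs hmax
  refine ⟨s, hs.2.1, hs.2.2, fun n hn hA => ?_, haxis, hX, hYV, hY⟩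
  have h1 := hmax n ⟨mem_right_of_adj hn, hn, hA⟩
  rw [div_le_div_iff₀ hA hs.2.2] at h1
  have h2 := F.area_mul_side X Y s n
  rw [← F.neg_area Y X n, ← F.neg_area Y X s] at h2
  nlinarith

theorem IsWedge.clear (hS : Separates F G) {X Y s a b : ℝ × ℝ} (h : IsWedge F G X Y s)
    (hX : 0 < F.area a b X) (hY : F.area a b Y ≤ 0)
    (hbelow : ∀ g ∈ G.verts, InWedge F X Y s g → 0 < F.area Y X g → F.area a b g ≤ 0) :
    Clear F G X Y (fun w => InWedge F X Y s w ∧ 0 < F.area X s w) a b := by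
  intro s₁ s₂ hst p hp hPp hAp hEp
  obtain ⟨⟨-, -, hCp⟩, hBp⟩ := hPp
  have hs : F.area a b s ≤ 0 := hbelow s (mem_right_of_adj h.adj)
    ⟨h.area_pos.le, by simp, by simp⟩ h.area_pos
  have hΔ := h.area_pos
  have hXV := G.mem_verts_of_adj _ _ h.adj
  have hs₁V := G.mem_verts_of_adj _ _ hst
  by_contra hE
  push Not at hE
  by_cases hT : InWedge F X Y s s₁
  · rcases hT.1.lt_or_eq with hA | hA
    · exact hE.not_ge (hbelow s₁ hs₁V hT hA)
    · rcases h.axis s₁ s₂ hst s₁ (left_mem_segment ℝ _ _)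
        (mem_segment_of_inWedge_of_axis hΔ hT hA.symm) with rfl | rfl | h0
      · obtain ⟨l, m, hl, hm, hlm, rfl⟩ := hp
        rw [F.area_comb hlm] at hAp hBp
        simp only [Frame.area_left, Frame.area_right, mul_zero, zero_add] at hAp hBp
        have hA2 : 0 < F.area Y s₁ s₂ := pos_of_mul_pos_right hAp hm
        have hB2 : 0 < F.area s₁ s s₂ := pos_of_mul_pos_right hBp hm
        exact hB2.not_ge (h.extremal s₂ hst hA2)
      · exact hE.not_ge hY
      · obtain ⟨l, m, hl, hm, hlm, rfl⟩ := hp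
        rw [F.area_comb hlm, h0.1, h0.2] at hAp
        simp at hAp
  · have hneg : F.area Y X s₁ < 0 ∨ F.area X s s₁ < 0 := by
      by_contra hcon
      push Not at hcon
      have hC : F.area s Y s₁ < 0 := by
        by_contra hC
        push Not at hC
        exact hT ⟨hcon.1, hcon.2, hC⟩
      have := F.area_barycentric X Y s a b s₁
      have h1 := mul_pos hΔ hE
      have h2 := mul_neg_of_neg_of_pos hC hX
      have h3 := mul_nonpos_of_nonneg_of_nonpos hcon.2 hY
      have h4 := mul_nonpos_of_nonneg_of_nonpos hcon.1 hs
      linarith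
    obtain ⟨t, ht0, ht1, hA, hB, h0⟩ := exists_exit hAp hBp hneg
    have ht : 1 - t + t = 1 := by ring
    rw [← F.area_comb ht] at hA hB
    rw [← F.area_comb ht, ← F.area_comb ht] at h0
    have hEq : 0 < F.area a b ((1 - t) • p + t • s₁) := by
      rw [F.area_comb ht]
      have := mul_nonneg (sub_nonneg.2 ht1.le) hEp
      have := mul_pos ht0 hE
      linarith
    have hqs : (1 - t) • p + t • s₁ ∈ segment ℝ s₁ s₂ :=
      convex_segment s₁ s₂ hp (left_mem_segment ℝ _ _) (by linarith) ht0.le ht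
    have hAq : 0 < (1 - t) * F.area Y X p := mul_pos (by linarith) hAp
    have hAq' := F.area_comb ht Y X p s₁
    set q := (1 - t) • p + t • s₁ with hq
    have hC : 0 ≤ F.area s Y q := by
      have := F.area_barycentric X Y s a b q
      have h1 := mul_pos hΔ hEq
      have h3 := mul_nonpos_of_nonneg_of_nonpos hB hY
      have h4 := mul_nonpos_of_nonneg_of_nonpos hA hs
      have h5 : 0 < F.area s Y q * F.area a b X := by linarith
      exact (pos_of_mul_pos_left h5 hX.le).le
    have hqT : InWedge F X Y s q := ⟨hA, hB, hC⟩
    have hqX : q ≠ X := by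
      intro hqX
      rw [hqX] at hqs hAq'
      rcases hS.nonCrossing.1 s₁ s₂ hst X hXV hqs with rfl | rfl
      · simp at hneg
      · obtain ⟨l, m, hl, hm, hlm, rfl⟩ := hp
        have hAp' := hAp
        rw [F.area_comb hlm] at hAp'
        simp only [Frame.area_right, mul_zero, add_zero] at hAp' hAq'
        have : 0 < F.area Y X s₁ := pos_of_mul_pos_right hAp' hl
        have := mul_pos ht0 this
        linarith
    rcases h0 with h0 | h0
    · rcases h.axis s₁ s₂ hst q hqs (mem_segment_of_inWedge_of_axis hΔ hqT h0) with h1 | h1 | h1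
      · exact hqX h1
      · rw [h1] at hEq
        exact hEq.not_ge hY
      · obtain ⟨l, m, hl, hm, hlm, rfl⟩ := hp
        rw [F.area_comb hlm, h1.1, h1.2] at hAp
        simp at hAp
    · have hqXs := mem_segment_of_inWedge_of_edge hΔ hqT h0
      by_cases heq : s(X, s) = s(s₁, s₂)
      · obtain ⟨l, m, hl, hm, hlm, rfl⟩ := hp
        rw [F.area_comb hlm] at hBp
        rcases Sym2.eq_iff.1 heq with ⟨rfl, rfl⟩ | ⟨rfl, rfl⟩ <;> simp at hBp
      · rcases (hS.nonCrossing.2 X s s₁ s₂ h.adj hst heq q hqXs hqs).1 with h1 | h1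
        · exact hqX h1
        · rw [h1] at hEq
          exact hEq.not_ge hs

theorem IsWedge.isRegion (hS : Separates F G) {X Y s : ℝ × ℝ} (h : IsWedge F G X Y s) :
    IsRegion F (InWedge F X Y s) (fun w => InWedge F X Y s w ∧ 0 < F.area X s w) where
  sub w hw := hw.1
  star u w hu hw l m hl hm hlm := by
    obtain ⟨h1, h2, h3⟩ := hu
    obtain ⟨⟨h4, h5, h6⟩, h7⟩ := hw
    refine ⟨⟨?_, ?_, ?_⟩, ?_⟩ <;> rw [F.area_comb hlm] <;> positivity
  right g hg hgs := by
    refine ⟨hg, hg.2.1.lt_of_ne fun h0 => ?_⟩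
    obtain ⟨l, m, hl, hm, hlm, rfl⟩ := mem_segment_of_inWedge_of_edge h.area_pos hg h0.symm
    rw [F.side_comb hlm] at hgs
    nlinarith [h.side_left, hS.side_neg h.adj h.side_left]

/-- A triangle between an edge and a segment contains an upper bridge. -/
theorem IsWedge.exists_isBridge (hS : Separates F G) {X Y s : ℝ × ℝ} (h : IsWedge F G X Y s) :
    ∃ a b, IsBridge F G X Y (InWedge F X Y s)
      (fun w => InWedge F X Y s w ∧ 0 < F.area X s w) a b := by
  have hΔ := h.area_pos
  refine GeomGraph.exists_isBridge hS (h.isRegion hS) h.mem_right h.side_right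
    ⟨⟨by simp, by rw [F.area_rotate]; exact hΔ.le, by simp⟩, by rw [F.area_rotate]; exact hΔ⟩
    ⟨s, mem_right_of_adj h.adj, hS.side_neg h.adj h.side_left,
      ⟨hΔ.le, by simp, by simp⟩, hΔ⟩ ?_
  intro a b ha haA hb hbA hbelow hY
  have h1 := h.side_left
  have h2 := h.side_right
  exact h.clear hS (F.area_pos_of_axis (by linarith) (by linarith) (by linarith) haA hbA hY
    (by simp) (by linarith)) hY hbelow

variable (F G)

/-- A free segment across the zero set of `side` such that both endpoints have an edge
pointing weakly below it, and one of them has an edge pointing strictly below it. -/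
structure IsGoodPair (x y : ℝ × ℝ) : Prop where
  mem_left : x ∈ G.verts
  side_left : F.side x < 0
  mem_right : y ∈ G.verts
  side_right : 0 < F.side y
  sees : Sees G x y
  left : ∃ z, G.Adj x z ∧ 0 ≤ F.area y x z
  right : ∃ t, G.Adj y t ∧ 0 ≤ F.area y x t
  strict : (∃ z, G.Adj x z ∧ 0 < F.area y x z) ∨ ∃ t, G.Adj y t ∧ 0 < F.area y x t

/-- Vertices on different sides which see each other have the same colour. -/
def IsMonochromatic {C : Type*} (c : ℝ × ℝ → C) : Prop :=
  ∀ x ∈ G.verts, ∀ y ∈ G.verts, F.side x < 0 → 0 < F.side y → Sees G x y → c x = c y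

variable {F G}

theorem IsGoodPair.swap {x y : ℝ × ℝ} (h : IsGoodPair F G x y) :
    IsGoodPair F.swap G y x where
  mem_left := h.mem_right
  side_left := by rw [F.side_swap]; exact neg_neg_of_pos h.side_right
  mem_right := h.mem_left
  side_right := by rw [F.side_swap]; exact neg_pos_of_neg h.side_left
  sees := h.sees.symm
  left := by simpa only [F.area_swap] using h.right
  right := by simpa only [F.area_swap] using h.left
  strict := by simpa only [F.area_swap] using h.strict.symm

theorem IsMonochromatic.swap {C : Type*} {c : ℝ × ℝ → C} (h : IsMonochromatic F G c) :
    IsMonochromatic F.swap G c := by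
  intro x hx y hy hxs hys hsee
  rw [F.side_swap] at hxs hys
  exact (h y hy x hx (by linarith) (by linarith) hsee.symm).symm

variable {C : Type*} {c : ℝ × ℝ → C}

theorem not_mem_segment_of_side_pos {x y q : ℝ × ℝ} (hx : F.side x < 0) (hy : F.side y < 0)
    (hq : 0 < F.side q) : q ∉ segment ℝ x y := by
  rintro ⟨l, m, hl, hm, hlm, rfl⟩
  rw [F.side_comb hlm] at hq
  nlinarith

/-- A point weakly above the bridge, reached from a point of the wedge along a path which does
not leave it, is in the wedge. -/
theorem inWedge_of_area_nonneg {X Y s a b q : ℝ × ℝ} (hΔ : 0 < F.area Y X s)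
    (hX : 0 < F.area a b X) (hY : F.area a b Y ≤ 0) (hs : F.area a b s ≤ 0)
    (hA : 0 ≤ F.area Y X q) (hB : 0 ≤ F.area X s q) (hE : 0 ≤ F.area a b q) :
    InWedge F X Y s q := by
  refine ⟨hA, hB, ?_⟩
  by_contra hC
  push Not at hC
  have := F.area_barycentric X Y s a b q
  have h1 := mul_nonneg hΔ.le hE
  have h2 := mul_neg_of_neg_of_pos hC hX
  have h3 := mul_nonpos_of_nonneg_of_nonpos hB hY
  have h4 := mul_nonpos_of_nonneg_of_nonpos hA hs
  linarith

/-- Below a good pair with a strict edge on the left there is another one. -/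
theorem IsGoodPair.exists_height_lt_of_left (hS : Separates F G) (hm : IsMonochromatic F G c)
    (hc : ProperlyColoured G c) (hiso : ∀ v ∈ G.verts, ∃ n, G.Adj v n) {x y z : ℝ × ℝ}
    (h : IsGoodPair F G x y) (hz : G.Adj x z) (hzA : 0 < F.area y x z) :
    ∃ a b, IsGoodPair F G a b ∧ F.height a b < F.height x y := by
  obtain ⟨s, hw⟩ := exists_isWedge hz hzA h.side_left h.mem_right h.side_right
    (fun s t hst p hp hps => (h.sees.2 s t hst p hp hps).imp_right Or.inl)
  obtain ⟨a, b, hb⟩ := hw.exists_isBridge hS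
  have hR := hw.isRegion hS
  have hΔ := hw.area_pos
  have hx := h.side_left
  have hy := h.side_right
  have hss := hS.side_neg hw.adj hx
  have haA := hb.area_left
  have has := hb.side_left
  have hbs := hb.side_right
  have hEy := hb.below_axis
  have hsK : InWedge F x y s s := ⟨hΔ.le, by simp, by simp⟩
  have hxK : InWedge F x y s x := ⟨by simp, by simp, by rw [← F.area_rotate]; exact hΔ.le⟩
  have hEs : F.area a b s ≤ 0 := hb.below s (mem_right_of_adj hw.adj) hsK hΔ
  have hbA : 0 ≤ F.area y x b := by
    rcases hb.right with h | h
    · simp [h]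
    · exact h.2.le
  have hEx : 0 < F.area a b x := F.area_pos_of_axis (by linarith) (by linarith) (by linarith)
    haA hbA hEy (by simp) (by linarith)
  have haxis : ∀ v ∈ G.verts, InWedge F x y s v → F.area y x v = 0 → v = x ∨ v = y :=
    fun v hv hvK hvA => h.sees.1 v hv (mem_segment_of_inWedge_of_axis hΔ hvK hvA)
  have hsees : ∀ v ∈ G.verts, 0 < F.side v → InWedge F x y s v → F.area a b v = 0 →
      c x = c v := by
    intro v hv hvs hvK hEv
    rcases hvK.1.lt_or_eq with hvA | hvA
    · exact hm x h.mem_left v hv hx hvs <| sees_of_clear hR hb.clear hb.below hxK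
        (hR.right v hvK hvs) hEx.le hEv.ge (by linarith) (by simp) hvA.le (by simpa using hvA)
    · rcases haxis v hv hvK hvA.symm with rfl | rfl
      · rfl
      · exact hm x h.mem_left v hv hx hvs h.sees
  have hbK : InWedge F x y s b := by
    rcases hb.right with h | h
    · rw [h]
      exact ⟨by simp, by rw [F.area_rotate]; exact hΔ.le, by simp⟩
    · exact h.1
  have hcb : c x = c b := hsees b hb.mem_right hbs hbK (by simp)
  have hca : c a = c b := hm a hb.mem_left b hb.mem_right has hbs hb.sees
  have has' : a ≠ s := by
    rintro rfl
    exact hc x a hw.adj (hcb.trans hca.symm)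
  have haB : 0 < F.area x s a := by
    refine hb.region_left.2.1.lt_of_ne fun h0 => ?_
    rcases hS.nonCrossing.1 x s hw.adj a hb.mem_left
      (mem_segment_of_inWedge_of_edge hΔ hb.region_left h0.symm) with rfl | h1
    · simp at haA
    · exact has' h1
  have hna : ∀ n, G.Adj a n → F.area a b n ≤ 0 := fun n hn =>
    hb.clear n a (G.symm _ _ hn) a (right_mem_segment ℝ _ _) ⟨hb.region_left, haB⟩ haA
      (by simp)
  have hbetween : ∀ v ∈ G.verts, 0 < F.side v → F.side v ≤ F.side b → F.area a b v = 0 →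
      v = b := by
    intro v hv hvs hvb hEv
    rcases hb.sees.1 v hv (F.mem_segment_of_area_eq_zero hEv (by linarith) (by linarith) hvb)
      with rfl | h1
    · linarith
    · exact h1
  have hnb : ∃ n, G.Adj b n ∧ F.area a b n < 0 := by
    rcases hb.right with hby | ⟨-, hbA'⟩
    · obtain ⟨t, ht, htA⟩ := h.right
      refine ⟨t, hby ▸ ht, ?_⟩
      by_contra hEt
      push Not at hEt
      have htV := mem_right_of_adj ht
      have hts := hS.side_pos ht hy
      have hty : t ≠ y := fun h => G.loopless y (h ▸ ht)
      have hEt0 : F.area a b t ≤ 0 := by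
        have htK : InWedge F x y s t := by
          refine inWedge_of_area_nonneg hΔ hEx hEy hEs htA ?_ hEt
          by_contra hB
          push Not at hB
          have hyB : 0 < F.area x s y := by rw [F.area_rotate]; exact hΔ
          obtain ⟨r, hr0, hr1, -, hB', h0⟩ := exists_exit one_pos hyB
            (Or.inr hB : (1 : ℝ) < 0 ∨ _)
          replace h0 : (1 - r) * F.area x s y + r * F.area x s t = 0 := by
            rcases h0 with h0 | h0
            · linarith
            · exact h0
          have hr : 1 - r + r = 1 := by ring
          rw [← F.area_comb hr] at hB' h0
          refine not_mem_segment_of_side_pos hx hss ?_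
            (mem_segment_of_inWedge_of_edge hΔ
              (inWedge_of_area_nonneg hΔ hEx hEy hEs ?_ hB' ?_) h0)
          · rw [F.side_comb hr]
            nlinarith
          · rw [F.area_comb hr]
            simpa using mul_nonneg hr0.le htA
          · rw [F.area_comb hr, ← hby]
            simpa using mul_nonneg hr0.le hEt
        rcases htA.lt_or_eq with htA' | htA'
        · exact hb.below t htV htK htA'
        · rcases haxis t htV htK htA'.symm with rfl | h1
          · linarith
          · exact absurd h1 hty
      have hEt' := le_antisymm hEt0 hEt
      have htb : F.side b < F.side t := by
        by_contra hcon
        push Not at hcon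
        exact hty ((hbetween t htV hts hcon hEt').trans hby)
      obtain ⟨l, m, hl, hm', hlm, hmem⟩ := F.mem_segment_of_area_eq_zero (a := a) (b := t)
        (g := b) (by rw [F.area_flip, hEt', neg_zero]) (by linarith) (by linarith) htb.le
      have hAb := F.area_comb hlm y x a t
      rw [hmem, hby, F.area_left] at hAb
      have h1 := mul_nonneg hl haA.le
      have h2 := mul_nonneg hm' htA
      have h3 : l = 0 := (mul_eq_zero.1 (by linarith : l * F.area y x a = 0)).resolve_right haA.ne'
      rw [h3, zero_add] at hlm
      rw [h3, hlm, zero_smul, one_smul, zero_add] at hmem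
      exact hty (hmem.trans hby)
    · have hbP := hR.right b hbK hbs
      obtain ⟨n, hn⟩ := hiso b hb.mem_right
      have hnV := mem_right_of_adj hn
      have hns := hS.side_pos hn hbs
      refine ⟨n, hn, lt_of_le_of_ne (hb.clear n b (G.symm _ _ hn) b (right_mem_segment ℝ _ _) hbP
        hbA' (by simp)) fun hEn => hc b n hn ?_⟩
      rw [← hcb]
      refine hsees n hnV hns ?_ hEn
      by_contra hnK
      have hneg : F.area y x n < 0 ∨ F.area x s n < 0 := by
        by_contra hcon
        push Not at hcon
        exact hnK (inWedge_of_area_nonneg hΔ hEx hEy hEs hcon.1 hcon.2 hEn.ge)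
      obtain ⟨r, hr0, hr1, hA, hB, h0⟩ := exists_exit hbA' hbP.2 hneg
      have hr : 1 - r + r = 1 := by ring
      have hEq : F.area a b ((1 - r) • b + r • n) = 0 := by
        rw [F.area_comb hr, hEn]; simp
      have hqs : (1 - r) • b + r • n ∈ segment ℝ b n := ⟨_, _, by linarith, hr0.le, hr, rfl⟩
      rw [← F.area_comb hr] at hA hB
      rw [← F.area_comb hr, ← F.area_comb hr] at h0
      have hqK := inWedge_of_area_nonneg hΔ hEx hEy hEs hA hB hEq.ge
      rcases h0 with h0 | h0
      · rcases h.sees.2 b n hn _ hqs (mem_segment_of_inWedge_of_axis hΔ hqK h0) with h1 | h1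
        · rw [h1] at hEq
          exact hEx.ne' hEq
        · rw [h1] at hqs
          rcases hS.nonCrossing.1 b n hn y h.mem_right hqs with h2 | h2
          · rw [← h2] at hbA'
            simp at hbA'
          · rw [← h2, F.area_rotate y x s, F.area_left] at hneg
            rcases hneg with h3 | h3 <;> linarith
      · refine not_mem_segment_of_side_pos hx hss ?_ (mem_segment_of_inWedge_of_edge hΔ hqK h0)
        rw [F.side_comb hr]
        nlinarith
  refine ⟨a, b, ⟨hb.mem_left, has, hb.mem_right, hbs, hb.sees, ?_, ?_, Or.inr ?_⟩, ?_⟩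
  · obtain ⟨n, hn⟩ := hiso a hb.mem_left
    exact ⟨n, hn, by rw [← F.neg_area]; linarith [hna n hn]⟩
  · obtain ⟨n, hn, hE⟩ := hnb
    exact ⟨n, hn, by rw [← F.neg_area]; linarith⟩
  · obtain ⟨n, hn, hE⟩ := hnb
    exact ⟨n, hn, by rw [← F.neg_area]; linarith⟩
  · have hxy : F.side x < F.side y := by linarith
    have hab : F.side a < F.side b := by linarith
    have key := F.height_sub hxy hab
    rw [← F.neg_area y x a, ← F.neg_area y x b] at key
    have h1 := mul_pos hbs haA
    have h2 := mul_nonneg (neg_nonneg.2 has.le) hbA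
    have h3 := mul_pos F.norm_pos (by linarith : 0 < F.side b * F.area y x a +
      -F.side a * F.area y x b)
    have h4 := mul_pos (sub_pos.2 hab) (sub_pos.2 hxy)
    by_contra hcon
    push Not at hcon
    have h5 := mul_nonneg h4.le (sub_nonneg.2 hcon)
    nlinarith

/-- Below a good pair there is another one. -/
theorem IsGoodPair.exists_height_lt (hS : Separates F G) (hm : IsMonochromatic F G c)
    (hc : ProperlyColoured G c) (hiso : ∀ v ∈ G.verts, ∃ n, G.Adj v n) {x y : ℝ × ℝ}
    (h : IsGoodPair F G x y) :
    ∃ a b, IsGoodPair F G a b ∧ F.height a b < F.height x y := by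
  rcases h.strict with ⟨z, hz, hzA⟩ | ⟨t, ht, htA⟩
  · exact h.exists_height_lt_of_left hS hm hc hiso hz hzA
  · obtain ⟨b, a, hab, hlt⟩ := h.swap.exists_height_lt_of_left hS.swap hm.swap hc hiso ht
      (by rwa [F.area_swap])
    refine ⟨a, b, ?_, ?_⟩
    · simpa only [F.swap_swap] using hab.swap
    · rw [← F.height_swap a b, ← F.height_swap x y]
      exact hlt

/-- There are no good pairs if pairs of vertices seeing each other have the same colour. -/
theorem not_isGoodPair (hS : Separates F G) (hm : IsMonochromatic F G c)
    (hc : ProperlyColoured G c) (hiso : ∀ v ∈ G.verts, ∃ n, G.Adj v n) (x y : ℝ × ℝ) :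
    ¬ IsGoodPair F G x y := by
  classical
  intro h
  obtain ⟨p, hp, hmin⟩ := Finset.exists_min_image
    ((G.verts ×ˢ G.verts).filter fun p => IsGoodPair F G p.1 p.2) (fun p => F.height p.1 p.2)
    ⟨(x, y), by simp [h.mem_left, h.mem_right, h]⟩
  obtain ⟨a, b, hab, hlt⟩ := (Finset.mem_filter.1 hp).2.exists_height_lt hS hm hc hiso
  exact hlt.not_ge (hmin (a, b) (by simp [hab.mem_left, hab.mem_right, hab]))

variable (F G)

/-- A free segment across the zero set of `side` such that the graph is weakly below its line
and the edges at its endpoints are on this line. -/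
structure IsFlatPair (x y : ℝ × ℝ) : Prop where
  mem_left : x ∈ G.verts
  side_left : F.side x < 0
  mem_right : y ∈ G.verts
  side_right : 0 < F.side y
  sees : Sees G x y
  nonneg : ∀ g ∈ G.verts, 0 ≤ F.area y x g
  flat_left : ∀ n, G.Adj x n → F.area y x n = 0
  flat_right : ∀ n, G.Adj y n → F.area y x n = 0

variable {F G}

theorem IsFlatPair.swap {x y : ℝ × ℝ} (h : IsFlatPair F G x y) :
    IsFlatPair F.swap G y x where
  mem_left := h.mem_right
  side_left := by rw [F.side_swap]; exact neg_neg_of_pos h.side_right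
  mem_right := h.mem_left
  side_right := by rw [F.side_swap]; exact neg_pos_of_neg h.side_left
  sees := h.sees.symm
  nonneg := by simpa only [F.area_swap] using h.nonneg
  flat_left := by simpa only [F.area_swap] using h.flat_right
  flat_right := by simpa only [F.area_swap] using h.flat_left

theorem IsFlatPair.side_lt_or_lt {x y v : ℝ × ℝ} (h : IsFlatPair F G x y) (hv : v ∈ G.verts)
    (hv0 : F.area y x v = 0) (hx : v ≠ x) (hy : v ≠ y) :
    F.side v < F.side x ∨ F.side y < F.side v := by
  by_contra hcon
  push Not at hcon
  have h1 := h.side_left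
  have h2 := h.side_right
  rcases h.sees.1 v hv (F.mem_segment_of_area_eq_zero (by rw [← F.neg_area, hv0, neg_zero])
    (by linarith) hcon.1 hcon.2) with h3 | h3
  · exact hx h3
  · exact hy h3

theorem IsFlatPair.side_lt_of_adj (hS : Separates F G) {x y z : ℝ × ℝ}
    (h : IsFlatPair F G x y) (hz : G.Adj x z) : F.side z < F.side x := by
  have h1 := hS.side_neg hz h.side_left
  have h2 := h.side_right
  rcases h.side_lt_or_lt (mem_right_of_adj hz) (h.flat_left z hz)
    (by rintro rfl; exact G.loopless _ hz) (by rintro rfl; linarith) with h3 | h3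
  · exact h3
  · linarith

theorem IsFlatPair.side_lt_of_adj_right (hS : Separates F G) {x y t : ℝ × ℝ}
    (h : IsFlatPair F G x y) (ht : G.Adj y t) : F.side y < F.side t := by
  have := h.swap.side_lt_of_adj hS.swap ht
  rw [F.side_swap, F.side_swap] at this
  linarith

/-- An upper bridge ending weakly below an edge of the axis leads to a contradiction. -/
theorem IsBridge.false_of_axis (hS : Separates F G) (hm : IsMonochromatic F G c)
    (hc : ProperlyColoured G c) {X Y a b x y z : ℝ × ℝ} {K P : ℝ × ℝ → Prop}
    (hR : IsRegion F K P) (h : IsBridge F G X Y K P a b) (hX : F.side X < 0)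
    (hxz : G.Adj x z) (hx : F.side x < 0) (hxK : K x) (hzK : K z) (hx0 : F.area Y X x = 0)
    (hz0 : F.area Y X z = 0) (hyY : G.Adj y Y) (hy : 0 < F.side y) (hyP : P y)
    (hlt : F.side y < F.side Y) (hy0 : F.area Y X y = 0) : False := by
  have has := h.side_left
  have hbs := h.side_right
  have haA := h.area_left
  have hbA : 0 ≤ F.area Y X b := by
    rcases h.right with h | h
    · simp [h]
    · exact h.2.le
  have hE : ∀ w, F.area Y X w = 0 → F.side w < F.side b → 0 < F.area a b w := fun w =>
    F.area_pos_of_axis (by linarith) (by linarith) (by linarith) haA hbA h.below_axis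
  rcases h.right with rfl | ⟨hbK, hbA'⟩
  · have h1 := hm a h.mem_left b h.mem_right has hbs h.sees
    have hEy := hE y hy0 hlt
    have h2 := hm a h.mem_left y (G.mem_verts_of_adj _ _ hyY) has hy <|
      sees_of_clear hR h.clear h.below h.region_left hyP (by simp) hEy.le (by simpa using hEy)
        haA.le hy0.ge (by linarith)
    exact hc y b hyY (h2.symm.trans h1)
  · have key : ∀ v ∈ G.verts, F.side v < 0 → K v → F.area Y X v = 0 → c v = c b := by
      intro v hv hvs hvK hv0
      have hEv := hE v hv0 (by linarith)
      exact hm v hv b h.mem_right hvs hbs <|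
        sees_of_clear hR h.clear h.below hvK (hR.right b hbK hbs) hEv.le (by simp)
          (by simpa using hEv) hv0.ge hbA (by linarith)
    exact hc x z hxz ((key x (G.mem_verts_of_adj _ _ hxz) hx hxK hx0).trans
      (key z (mem_right_of_adj hxz) (hS.side_neg hxz hx) hzK hz0).symm)

theorem inWedge_of_mem_segment {X Y s p : ℝ × ℝ} (hs : 0 < F.area Y X s)
    (hp : p ∈ segment ℝ X Y) : InWedge F X Y s p := by
  obtain ⟨l, m, hl, hm, hlm, rfl⟩ := hp
  have h1 : F.area X s Y = F.area Y X s := F.area_rotate Y X s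
  have h2 : F.area s Y X = F.area Y X s := (F.area_rotate s Y X).symm
  refine ⟨?_, ?_, ?_⟩ <;> rw [F.area_comb hlm] <;> simp only [Frame.area_left, Frame.area_right,
    h1, h2, mul_zero, add_zero, zero_add, le_refl] <;> positivity

/-- The vertices on the line of a flat pair have no edges off this line on the left. -/
theorem IsFlatPair.area_eq_zero_of_adj (hS : Separates F G) (hm : IsMonochromatic F G c)
    (hc : ProperlyColoured G c) (hiso : ∀ v ∈ G.verts, ∃ n, G.Adj v n) {x y v n : ℝ × ℝ}
    (h : IsFlatPair F G x y) (hv : F.side v < 0) (hv0 : F.area y x v = 0) (hn : G.Adj v n) :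
    F.area y x n = 0 := by
  classical
  by_contra hne
  have hnpos := (h.nonneg n (mem_right_of_adj hn)).lt_of_ne' hne
  obtain ⟨X, hXm, hmax⟩ := Finset.exists_max_image
    (G.verts.filter fun v => F.side v < 0 ∧ F.area y x v = 0 ∧ ∃ n, G.Adj v n ∧ 0 < F.area y x n)
    F.side ⟨v, Finset.mem_filter.2 ⟨G.mem_verts_of_adj _ _ hn, hv, hv0, n, hn, hnpos⟩⟩
  obtain ⟨hXV, hX, hX0, k, hk, hkpos⟩ := Finset.mem_filter.1 hXm
  obtain ⟨z, hz⟩ := hiso x h.mem_left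
  obtain ⟨Y, hY⟩ := hiso y h.mem_right
  have hx := h.side_left
  have hy := h.side_right
  have hxy : F.side x < F.side y := by linarith
  have hzV := mem_right_of_adj hz
  have hYV := mem_right_of_adj hY
  have hzx := h.side_lt_of_adj hS hz
  have hyY := h.side_lt_of_adj_right hS hY
  have hz0 := h.flat_left z hz
  have hY0 := h.flat_right Y hY
  have hXx : F.side X < F.side x := by
    rcases h.side_lt_or_lt hXV hX0 (by rintro rfl; linarith [h.flat_left k hk])
      (by rintro rfl; linarith) with h1 | h1
    · exact h1
    · linarith
  have hbase : ∀ p q, F.area y x p = 0 → F.area y x q = 0 → F.side p < F.side q →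
      ∀ r, F.area y x r = 0 → F.side p ≤ F.side r → F.side r ≤ F.side q →
        r ∈ segment ℝ p q := by
    intro p q hp hq hpq r hr
    refine F.mem_segment_of_area_eq_zero ?_ hpq
    have := F.area_change_base hq hp r
    rw [hr, mul_zero] at this
    exact (mul_eq_zero.1 this).resolve_left (by linarith)
  have hXz : F.side X ≤ F.side z := by
    by_contra hcon
    push Not at hcon
    rcases hS.nonCrossing.1 z x (G.symm _ _ hz) X hXV
      (hbase z x hz0 (by simp) hzx X hX0 hcon.le hXx.le) with rfl | rfl
    · exact hcon.false
    · exact hXx.false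
  have hXY : F.side X < F.side Y := by linarith
  have hA0 : ∀ r, F.area Y X r = 0 ↔ F.area y x r = 0 := by
    intro r
    have := F.area_change_base hX0 hY0 r
    constructor
    · intro h0
      rw [h0, mul_zero] at this
      exact (mul_eq_zero.1 this.symm).resolve_left (by linarith)
    · intro h0
      rw [h0, mul_zero] at this
      exact (mul_eq_zero.1 this).resolve_left (by linarith)
  have hApos : ∀ r, 0 < F.area y x r → 0 < F.area Y X r := by
    intro r hr
    have := F.area_change_base hX0 hY0 r
    have h1 := mul_pos (sub_pos.2 hXY) hr
    exact (mul_pos_iff_of_pos_left (sub_pos.2 hxy)).1 (by linarith)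
  have hsegA : ∀ p ∈ segment ℝ X Y, F.area y x p = 0 := by
    rintro _ ⟨l, m, hl, hm, hlm, rfl⟩
    rw [F.area_comb hlm, hX0, hY0]
    simp
  have hflat : ∀ v ∈ segment ℝ X Y, v ≠ X → v ≠ Y → ∀ n, G.Adj v n →
      F.area y x v = 0 ∧ F.area y x n = 0 := by
    intro v hvs hvX hvY n hn
    have hvV := G.mem_verts_of_adj _ _ hn
    have hv0 := hsegA v hvs
    refine ⟨hv0, ?_⟩
    by_contra hne
    have hnpos := (h.nonneg n (mem_right_of_adj hn)).lt_of_ne' hne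
    obtain ⟨l, m, hl, hm, hlm, hlmv⟩ := exists_comb_of_mem_segment hvs hvX hvY
    have hside := F.side_comb hlm X Y
    rw [hlmv] at hside
    obtain rfl : l = 1 - m := by linarith
    rcases (hS.side_ne v hvV).lt_or_gt with h1 | h1
    · have := hmax v (Finset.mem_filter.2 ⟨hvV, h1, hv0, n, hn, hnpos⟩)
      nlinarith
    · have hvy : v ≠ y := by
        rintro rfl
        exact hne (h.flat_right n hn)
      rcases h.side_lt_or_lt hvV hv0 (by rintro rfl; linarith) hvy with h2 | h2
      · linarith
      · rcases hS.nonCrossing.1 y Y hY v hvV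
          (hbase y Y (by simp) hY0 hyY v hv0 h2.le (by nlinarith)) with h3 | h3
        · exact hvy h3
        · exact hvY h3
  obtain ⟨s, hw⟩ := exists_isWedge hk (hApos k hkpos) hX hYV (by linarith : 0 < F.side Y) <| by
    intro s t hst p hp hps
    by_contra! hcon
    obtain ⟨hpX, hpY, hcon⟩ := hcon
    rw [hA0, Ne, hA0] at hcon
    by_cases h1 : p = s
    · subst h1
      have := hflat p hps hpX hpY t hst
      exact hcon this.1 this.2
    · by_cases h2 : p = t
      · subst h2
        have := hflat p hps hpX hpY s (G.symm _ _ hst)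
        exact hcon this.2 this.1
      · have hp0 := hsegA p hps
        obtain ⟨l, m, hl, hm, hlm, rfl⟩ := exists_comb_of_mem_segment hp h1 h2
        rw [F.area_comb hlm] at hp0
        have h3 := h.nonneg s (G.mem_verts_of_adj _ _ hst)
        have h4 := h.nonneg t (mem_right_of_adj hst)
        exact hcon (by nlinarith) (by nlinarith)
  obtain ⟨a, b, hb⟩ := hw.exists_isBridge hS
  have hin : ∀ r, F.area y x r = 0 → F.side X ≤ F.side r → F.side r ≤ F.side Y →
      InWedge F X Y s r := fun r h0 h1 h2 =>
    inWedge_of_mem_segment hw.area_pos (hbase X Y hX0 hY0 hXY r h0 h1 h2)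
  refine hb.false_of_axis hS hm hc (hw.isRegion hS) hX hz hx
    (hin x (by simp) hXx.le (by linarith)) (hin z hz0 hXz (by linarith)) ((hA0 x).2 (by simp))
    ((hA0 z).2 hz0) hY hy ?_ hyY ((hA0 y).2 (by simp))
  exact (hw.isRegion hS).right y (hin y (by simp) (by linarith) hyY.le) hy

/-- The left part of a graph with a flat pair is on the line of this pair. -/
theorem IsFlatPair.area_eq_zero_of_side_neg (hS : Separates F G) (hm : IsMonochromatic F G c)
    (hc : ProperlyColoured G c) (hiso : ∀ v ∈ G.verts, ∃ n, G.Adj v n) {x y w : ℝ × ℝ}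
    (h : IsFlatPair F G x y) (hw : w ∈ G.verts) (hws : F.side w < 0) : F.area y x w = 0 := by
  by_contra hne
  have hwpos := (h.nonneg w hw).lt_of_ne' hne
  have hflat : ∀ v n, G.Adj v n → F.area y x v = 0 → F.area y x n = 0 := by
    intro v n hn hv0
    have hv := G.mem_verts_of_adj _ _ hn
    rcases (hS.side_ne v hv).lt_or_gt with h1 | h1
    · exact h.area_eq_zero_of_adj hS hm hc hiso h1 hv0 hn
    · have := h.swap.area_eq_zero_of_adj hS.swap hm.swap hc hiso (v := v) (n := n)
        (by rw [F.side_swap]; linarith) (by rwa [F.area_swap]) hn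
      rwa [F.area_swap] at this
  obtain ⟨z, hz⟩ := hiso x h.mem_left
  obtain ⟨Y, hY⟩ := hiso y h.mem_right
  have hx := h.side_left
  have hy := h.side_right
  have hyY := h.side_lt_of_adj_right hS hY
  have hY0 := h.flat_right Y hY
  have hxy : 0 < F.side y - F.side x := by linarith
  have hxY : 0 < F.side Y - F.side x := by linarith
  have hbase := F.area_change_base (F.area_right y x) hY0
  have hA0 : ∀ r, F.area y x r = 0 → F.area Y x r = 0 := by
    intro r h0
    have := hbase r
    rw [h0, mul_zero] at this
    exact (mul_eq_zero.1 this).resolve_left hxy.ne'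
  have hApos : ∀ r, 0 < F.area Y x r ↔ 0 < F.area y x r := by
    intro r
    rw [← mul_pos_iff_of_pos_left hxy, hbase, mul_pos_iff_of_pos_left hxY]
  have hR : IsRegion F (fun _ => True) (fun _ => True) :=
    ⟨fun _ _ => trivial, fun _ _ _ _ _ _ _ _ _ => trivial, fun _ _ _ => trivial⟩
  obtain ⟨a, b, hb⟩ := exists_isBridge (X := x) hS hR (mem_right_of_adj hY) (by linarith)
    trivial ⟨w, hw, hws, trivial, (hApos w).2 hwpos⟩ <| by
      intro a b _ _ _ _ hbelow _ s t hst p hp _ hAp _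
      by_contra hE
      have hsV := G.mem_verts_of_adj _ _ hst
      have hs0 : F.area y x s = 0 := by
        by_contra hs0
        exact hE (hbelow s hsV trivial ((hApos s).2 ((h.nonneg s hsV).lt_of_ne' hs0)))
      have ht0 := hflat s t hst hs0
      obtain ⟨l, m, hl, hm, hlm, rfl⟩ := hp
      rw [hApos, F.area_comb hlm, hs0, ht0] at hAp
      simp at hAp
  exact hb.false_of_axis hS hm hc hR hx hz hx trivial trivial (by simp)
    (hA0 z (h.flat_left z hz)) hY hy trivial hyY (hA0 y (by simp))

/-- If no vertex is isolated and the vertices are not collinear, then there are vertices of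
different colours on different sides which see each other. -/
theorem not_isMonochromatic_of_forall_adj (hS : Separates F G) (hc : ProperlyColoured G c)
    (hiso : ∀ v ∈ G.verts, ∃ n, G.Adj v n) (hl : ∃ v ∈ G.verts, F.side v < 0)
    (hr : ∃ v ∈ G.verts, 0 < F.side v)
    (hncol : ∀ p q, p ≠ q → ∃ w ∈ G.verts, F.area p q w ≠ 0) : ¬ IsMonochromatic F G c := by
  classical
  intro hm
  obtain ⟨x, hx, y, hy, hle, hgap⟩ := F.exists_bridge (G.verts.filter fun v => F.side v < 0)
    (G.verts.filter fun v => 0 < F.side v) (by simpa [Finset.filter_nonempty_iff] using hl)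
    (by simpa [Finset.filter_nonempty_iff] using hr) (by simp) (by simp)
  have hmem : ∀ g ∈ G.verts, g ∈ (G.verts.filter fun v => F.side v < 0) ∨
      g ∈ (G.verts.filter fun v => 0 < F.side v) := fun g hg =>
    (hS.side_ne g hg).lt_or_gt.imp (fun h => by simp [hg, h]) (fun h => by simp [hg, h])
  rw [Finset.mem_filter] at hx hy
  have hsees : Sees G x y := sees_of_below hS (Q := fun _ => True) hx.2 hy.2
    (fun _ _ _ _ => trivial) (fun z hz _ => hgap z (hmem z hz))
    (fun s t hst _ _ _ _ => hle s (hmem s (G.mem_verts_of_adj _ _ hst)))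
  have hnonneg : ∀ g ∈ G.verts, 0 ≤ F.area y x g := fun g hg => by
    rw [← F.neg_area]; linarith [hle g (hmem g hg)]
  obtain ⟨z, hz⟩ := hiso x hx.1
  obtain ⟨t, ht⟩ := hiso y hy.1
  have hflat : ¬ ((∃ z, G.Adj x z ∧ 0 < F.area y x z) ∨ ∃ t, G.Adj y t ∧ 0 < F.area y x t) :=
    fun h => not_isGoodPair hS hm hc hiso x y ⟨hx.1, hx.2, hy.1, hy.2, hsees,
      ⟨z, hz, hnonneg z (mem_right_of_adj hz)⟩, ⟨t, ht, hnonneg t (mem_right_of_adj ht)⟩, h⟩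
  push Not at hflat
  have hpair : IsFlatPair F G x y := ⟨hx.1, hx.2, hy.1, hy.2, hsees, hnonneg,
    fun n hn => le_antisymm (hflat.1 n hn) (hnonneg n (mem_right_of_adj hn)),
    fun n hn => le_antisymm (hflat.2 n hn) (hnonneg n (mem_right_of_adj hn))⟩
  obtain ⟨w, hw, hne⟩ := hncol y x (by rintro rfl; linarith [hx.2, hy.2])
  rcases (hS.side_ne w hw).lt_or_gt with h | h
  · exact hne (hpair.area_eq_zero_of_side_neg hS hm hc hiso hw h)
  · have := hpair.swap.area_eq_zero_of_side_neg hS.swap hm.swap hc hiso hw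
      (by rw [F.side_swap]; linarith)
    rw [F.area_swap] at this
    exact hne this

theorem Sees.mono {H : GeomGraph} {x y : ℝ × ℝ} (h : Sees H x y) (hV : G.verts ⊆ H.verts)
    (hAdj : ∀ s t, G.Adj s t → H.Adj s t) : Sees G x y :=
  ⟨fun z hz => h.1 z (hV hz), fun s t hst => h.2 s t (hAdj s t hst)⟩

/-- The graph with an isolated vertex deleted. -/
noncomputable def eraseIsolated (G : GeomGraph) (v : ℝ × ℝ) (hv : ∀ n, ¬ G.Adj v n) : GeomGraph where
  verts := G.verts.erase v
  Adj := G.Adj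
  symm := G.symm
  loopless := G.loopless
  mem_verts_of_adj x y h :=
    Finset.mem_erase.2 ⟨by rintro rfl; exact hv y h, G.mem_verts_of_adj x y h⟩

/-- The graph with an edge added. -/
def addEdge (G : GeomGraph) (a b : ℝ × ℝ) (ha : a ∈ G.verts) (hb : b ∈ G.verts) (hab : a ≠ b) :
    GeomGraph where
  verts := G.verts
  Adj x y := G.Adj x y ∨ s(x, y) = s(a, b)
  symm x y h := by rwa [Sym2.eq_swap, or_congr_left ⟨G.symm y x, G.symm x y⟩]
  loopless x h := by
    rcases h with h | h
    · exact G.loopless x h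
    · rcases Sym2.eq_iff.1 h with ⟨rfl, rfl⟩ | ⟨rfl, rfl⟩ <;> exact hab rfl
  mem_verts_of_adj x y h := by
    rcases h with h | h
    · exact G.mem_verts_of_adj x y h
    · rcases Sym2.eq_iff.1 h with ⟨rfl, rfl⟩ | ⟨rfl, rfl⟩
      · exact ha
      · exact hb

theorem segment_eq_of_sym2_eq {x y a b : ℝ × ℝ} (h : s(x, y) = s(a, b)) :
    segment ℝ x y = segment ℝ a b := by
  rcases Sym2.eq_iff.1 h with ⟨rfl, rfl⟩ | ⟨rfl, rfl⟩
  · rfl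
  · exact segment_symm ℝ _ _

theorem eq_or_eq_of_sym2_eq {x y a b p : ℝ × ℝ} (h : s(x, y) = s(a, b)) (hp : p = a ∨ p = b) :
    p = x ∨ p = y := by
  rcases Sym2.eq_iff.1 h with ⟨rfl, rfl⟩ | ⟨rfl, rfl⟩
  · exact hp
  · exact hp.symm

theorem addEdge_nonCrossing (h : GeomNonCrossing G) {a b : ℝ × ℝ} (ha : a ∈ G.verts)
    (hb : b ∈ G.verts) (hab : a ≠ b) (hsees : Sees G a b) :
    GeomNonCrossing (G.addEdge a b ha hb hab) := by
  have key : ∀ x y z w, G.Adj x y → s(z, w) = s(a, b) → ∀ p ∈ segment ℝ x y,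
      p ∈ segment ℝ z w → (p = x ∨ p = y) ∧ (p = z ∨ p = w) := by
    intro x y z w hxy hzw p hp hp'
    rw [segment_eq_of_sym2_eq hzw] at hp'
    have hpab := hsees.2 x y hxy p hp hp'
    refine ⟨?_, eq_or_eq_of_sym2_eq hzw hpab⟩
    rcases hpab with rfl | rfl
    · exact h.1 x y hxy p ha hp
    · exact h.1 x y hxy p hb hp
  constructor
  · rintro x y (hxy | hxy) v hv hvs
    · exact h.1 x y hxy v hv hvs
    · rw [segment_eq_of_sym2_eq hxy] at hvs
      exact eq_or_eq_of_sym2_eq hxy (hsees.1 v hv hvs)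
  · rintro x y z w (hxy | hxy) (hzw | hzw) hne p hp hp'
    · exact h.2 x y z w hxy hzw hne p hp hp'
    · exact key x y z w hxy hzw p hp hp'
    · exact (key z w x y hzw hxy p hp' hp).symm
    · exact absurd (hxy.trans hzw.symm) hne

/-- If the vertices of a separated properly coloured graph with edges on both sides are not
collinear, then there are vertices of different colours on different sides which see each
other. -/
theorem not_isMonochromatic (hS : Separates F G) (hc : ProperlyColoured G c)
    (hl : ∃ x y, G.Adj x y ∧ F.side x < 0) (hr : ∃ x y, G.Adj x y ∧ 0 < F.side x)
    (hncol : ∀ p q, p ≠ q → ∃ w ∈ G.verts, F.area p q w ≠ 0) : ¬ IsMonochromatic F G c := by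
  classical
  induction hn : (G.verts.filter fun v => ∀ n, ¬ G.Adj v n).card using Nat.strong_induction_on
    generalizing F G with
  | _ k ih =>
  by_cases hiso : ∀ v ∈ G.verts, ∃ n, G.Adj v n
  · obtain ⟨x, y, hxy, hx⟩ := hl
    obtain ⟨x', y', hxy', hx'⟩ := hr
    exact not_isMonochromatic_of_forall_adj hS hc hiso ⟨x, G.mem_verts_of_adj _ _ hxy, hx⟩
      ⟨x', G.mem_verts_of_adj _ _ hxy', hx'⟩ hncol
  push Not at hiso
  obtain ⟨v, hvV, hv⟩ := hiso
  wlog hvs : F.side v < 0 generalizing F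
  · intro hm
    refine this (F := F.swap) hS.swap (by simpa [F.side_swap] using hr)
      (by simpa [F.side_swap] using hl) (fun p q hpq => ?_) ?_ hm.swap
    · obtain ⟨w, hw, hne⟩ := hncol q p hpq.symm
      exact ⟨w, hw, by rwa [F.area_swap]⟩
    · rw [F.side_swap]
      exact neg_neg_of_pos ((hS.side_ne v hvV).lt_or_gt.resolve_left hvs)
  intro hm
  by_cases hcol : ∀ p q, p ≠ q → ∃ w ∈ G.verts.erase v, F.area p q w ≠ 0
  · have hlt : ((G.verts.erase v).filter fun v => ∀ n, ¬ G.Adj v n).card < k := by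
      rw [← hn]
      refine Finset.card_lt_card (Finset.ssubset_iff_subset_ne.2
        ⟨Finset.filter_subset_filter _ (Finset.erase_subset _ _), fun heq => ?_⟩)
      have : v ∈ (G.verts.erase v).filter fun v => ∀ n, ¬ G.Adj v n := by
        rw [heq]; simpa [hvV] using hv
      simp at this
    have hS' : Separates F (G.eraseIsolated v hv) :=
      ⟨fun p hp => hS.side_ne p (Finset.mem_of_mem_erase hp), hS.side_mul,
        fun x y hxy z hz => hS.nonCrossing.1 x y hxy z (Finset.mem_of_mem_erase hz),
        hS.nonCrossing.2⟩
    have := ih _ hlt hS' hc hl hr hcol rfl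
    unfold IsMonochromatic at this
    push Not at this
    obtain ⟨x, hx, y, hy, hxs, hys, hsees, hne⟩ := this
    obtain ⟨hxv, hxV⟩ := Finset.mem_erase.1 hx
    obtain ⟨hyv, hyV⟩ := Finset.mem_erase.1 hy
    have hvert : ∀ z ∈ G.verts, z ≠ v → z ∈ segment ℝ x y → z = x ∨ z = y :=
      fun z hz hzv => hsees.1 z (Finset.mem_erase.2 ⟨hzv, hz⟩)
    by_cases hvxy : v ∈ segment ℝ x y
    · have hxvs : F.side x < F.side v := by
        obtain ⟨l, m, hl, hm, hlm, h⟩ := exists_comb_of_mem_segment hvxy hxv.symm hyv.symm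
        rw [← h, F.side_comb hlm]
        nlinarith
      have hsub₁ := (convex_segment x y).segment_subset hvxy (right_mem_segment ℝ x y)
      have hsub₂ := (convex_segment x y).segment_subset (left_mem_segment ℝ x y) hvxy
      have hx' : x ∉ segment ℝ v y := by
        rintro ⟨l, m, hl, hm, hlm, h⟩
        have := F.side_comb hlm v y
        rw [h] at this
        nlinarith
      have hy' : y ∉ segment ℝ x v := not_mem_segment_of_side_pos hxs hvs hys
      have hsees₁ : Sees G v y := by
        refine ⟨fun z hz hzs => ?_, fun s t hst p hp hps => ?_⟩
        · by_contra! hcon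
          rcases hvert z hz hcon.1 (hsub₁ hzs) with rfl | rfl
          · exact hx' hzs
          · exact hcon.2 rfl
        · rcases hsees.2 s t hst p hp (hsub₁ hps) with rfl | rfl
          · exact absurd hps hx'
          · exact Or.inr rfl
      have hsees₂ : Sees G x v := by
        refine ⟨fun z hz hzs => ?_, fun s t hst p hp hps => ?_⟩
        · by_contra! hcon
          rcases hvert z hz hcon.2 (hsub₂ hzs) with rfl | rfl
          · exact hcon.1 rfl
          · exact hy' hzs
        · rcases hsees.2 s t hst p hp (hsub₂ hps) with rfl | rfl
          · exact Or.inl rfl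
          · exact absurd hps hy'
      have hcv : c v = c y := hm v hvV y hyV hvs hys hsees₁
      have hlt' : (G.verts.filter fun w => ∀ n, ¬ (G.Adj w n ∨ s(w, n) = s(x, v))).card < k := by
        rw [← hn]
        refine Finset.card_lt_card (Finset.ssubset_iff_subset_ne.2 ⟨?_, fun heq => ?_⟩)
        · exact Finset.monotone_filter_right _ fun w _ hw n hwn => hw n (Or.inl hwn)
        · have : v ∈ G.verts.filter fun w => ∀ n, ¬ (G.Adj w n ∨ s(w, n) = s(x, v)) := by
            rw [heq]; simpa [hvV] using hv
          exact (Finset.mem_filter.1 this).2 x (Or.inr Sym2.eq_swap)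
      have hS'' : Separates F (G.addEdge x v hxV hvV hxv) := by
        refine ⟨hS.side_ne, ?_, addEdge_nonCrossing hS.nonCrossing hxV hvV hxv hsees₂⟩
        rintro p q (hpq | hpq)
        · exact hS.side_mul p q hpq
        · rcases Sym2.eq_iff.1 hpq with ⟨rfl, rfl⟩ | ⟨rfl, rfl⟩
          · exact mul_pos_of_neg_of_neg hxs hvs
          · exact mul_pos_of_neg_of_neg hvs hxs
      have hc' : ProperlyColoured (G.addEdge x v hxV hvV hxv) c := by
        rintro p q (hpq | hpq)
        · exact hc p q hpq
        · rcases Sym2.eq_iff.1 hpq with ⟨rfl, rfl⟩ | ⟨rfl, rfl⟩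
          · rw [hcv]; exact hne
          · rw [hcv]; exact hne.symm
      refine ih _ hlt' hS'' hc' ?_ ?_ hncol rfl fun a ha b hb has hbs hab =>
        hm a ha b hb has hbs (hab.mono subset_rfl fun s t hst => Or.inl hst)
      · obtain ⟨p, q, hpq, h⟩ := hl
        exact ⟨p, q, Or.inl hpq, h⟩
      · obtain ⟨p, q, hpq, h⟩ := hr
        exact ⟨p, q, Or.inl hpq, h⟩
    · refine hne (hm x hxV y hyV hxs hys ⟨fun z hz hzs => ?_, hsees.2⟩)
      exact hvert z hz (by rintro rfl; exact hvxy hzs) hzs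
  · push Not at hcol
    obtain ⟨p, q, hpq, hcol⟩ := hcol
    have hcol' : ∀ z ∈ G.verts, z ≠ v → F.area p q z = 0 :=
      fun z hz hzv => hcol z (Finset.mem_erase.2 ⟨hzv, hz⟩)
    have hvA : F.area p q v ≠ 0 := by
      obtain ⟨w, hw, hne⟩ := hncol p q hpq
      by_cases h : w = v
      · rwa [← h]
      · exact absurd (hcol' w hw h) hne
    have hadj : ∀ s t, G.Adj s t → F.area p q s = 0 := fun s t hst =>
      hcol' s (G.mem_verts_of_adj _ _ hst) (by rintro rfl; exact hv t hst)
    have key : ∀ y n, G.Adj y n → 0 < F.side y → c v = c y := by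
      intro y n hy hys
      have hyA := hadj y n hy
      have hoff : ∀ r ∈ segment ℝ v y, r ≠ v → r ≠ y → F.area p q r ≠ 0 := by
        intro r hr hrv hry
        obtain ⟨l, m, hl, hm, hlm, rfl⟩ := exists_comb_of_mem_segment hr hrv hry
        rw [F.area_comb hlm, hyA, mul_zero, add_zero]
        exact mul_ne_zero hl.ne' hvA
      refine hm v hvV y (G.mem_verts_of_adj _ _ hy) hvs hys
        ⟨fun z hz hzs => ?_, fun s t hst r hr hrs => ?_⟩
      · by_contra! hcon
        exact hoff z hzs hcon.1 hcon.2 (hcol' z hz hcon.1)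
      · by_contra! hcon
        refine hoff r hrs hcon.1 hcon.2 ?_
        obtain ⟨l, m, hl, hm, hlm, rfl⟩ := hr
        rw [F.area_comb hlm, hadj s t hst, hadj t s (G.symm _ _ hst)]
        simp
    obtain ⟨y, y', hyy, hy⟩ := hr
    exact hc y y' hyy ((key y y' hyy hy).symm.trans
      (key y' y (G.symm _ _ hyy) (hS.side_pos hyy hy)))

/-- The union of two geometric graphs. -/
noncomputable def union (G₁ G₂ : GeomGraph) : GeomGraph where
  verts := G₁.verts ∪ G₂.verts
  Adj x y := G₁.Adj x y ∨ G₂.Adj x y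
  symm x y h := h.imp (G₁.symm x y) (G₂.symm x y)
  loopless x h := h.elim (G₁.loopless x) (G₂.loopless x)
  mem_verts_of_adj x y h := Finset.mem_union.2
    (h.imp (G₁.mem_verts_of_adj x y) (G₂.mem_verts_of_adj x y))

theorem segment_subset_convexHull_of_adj {x y : ℝ × ℝ} (h : G.Adj x y) :
    segment ℝ x y ⊆ convexHull ℝ (G.verts : Set (ℝ × ℝ)) :=
  segment_subset_convexHull (G.mem_verts_of_adj x y h) (mem_right_of_adj h)

theorem union_nonCrossing {G₁ G₂ : GeomGraph} (h₁ : GeomNonCrossing G₁)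
    (h₂ : GeomNonCrossing G₂) (hd : Disjoint (convexHull ℝ (G₁.verts : Set (ℝ × ℝ)))
      (convexHull ℝ (G₂.verts : Set (ℝ × ℝ)))) : GeomNonCrossing (G₁.union G₂) := by
  rw [Set.disjoint_left] at hd
  constructor
  · rintro x y (hxy | hxy) v hv hvs
    · rcases Finset.mem_union.1 hv with hv | hv
      · exact h₁.1 x y hxy v hv hvs
      · exact absurd (subset_convexHull ℝ _ hv) (hd (segment_subset_convexHull_of_adj hxy hvs))
    · rcases Finset.mem_union.1 hv with hv | hv
      · exact absurd (segment_subset_convexHull_of_adj hxy hvs) (hd (subset_convexHull ℝ _ hv))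
      · exact h₂.1 x y hxy v hv hvs
  · rintro x y z w (hxy | hxy) (hzw | hzw) hne p hp hp'
    · exact h₁.2 x y z w hxy hzw hne p hp hp'
    · exact absurd (segment_subset_convexHull_of_adj hzw hp')
        (hd (segment_subset_convexHull_of_adj hxy hp))
    · exact absurd (segment_subset_convexHull_of_adj hxy hp)
        (hd (segment_subset_convexHull_of_adj hzw hp'))
    · exact h₂.2 x y z w hxy hzw hne p hp hp'

/-- Disjoint convex hulls of finite sets are separated by the affine function of a frame. -/
theorem exists_frame {S T : Finset (ℝ × ℝ)} (hS : S.Nonempty) (hT : T.Nonempty)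
    (hd : Disjoint (convexHull ℝ (S : Set (ℝ × ℝ))) (convexHull ℝ (T : Set (ℝ × ℝ)))) :
    ∃ F : Frame, (∀ p ∈ S, F.side p < 0) ∧ ∀ p ∈ T, 0 < F.side p := by
  obtain ⟨f, a, b, ha, hab, hb⟩ := geometric_hahn_banach_compact_closed (convex_convexHull ℝ _)
    (S.finite_toSet.isCompact_convexHull ℝ) (convex_convexHull ℝ _)
    (T.finite_toSet.isClosed_convexHull ℝ) hd
  have hf : ∀ p : ℝ × ℝ, f p = f (1, 0) * p.1 + f (0, 1) * p.2 := by
    intro p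
    have hp : p = p.1 • ((1 : ℝ), (0 : ℝ)) + p.2 • ((0 : ℝ), (1 : ℝ)) := by ext <;> simp
    conv_lhs => rw [hp, map_add, map_smul, map_smul, smul_eq_mul, smul_eq_mul]
    ring
  have ha' : ∀ p ∈ S, f p < a := fun p hp => ha p (subset_convexHull ℝ _ hp)
  have hb' : ∀ p ∈ T, b < f p := fun p hp => hb p (subset_convexHull ℝ _ hp)
  have hnorm : 0 < f (1, 0) ^ 2 + f (0, 1) ^ 2 := by
    by_contra hcon
    have h1 : f (1, 0) = 0 := by nlinarith [sq_nonneg (f (1, 0)), sq_nonneg (f (0, 1))]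
    have h2 : f (0, 1) = 0 := by nlinarith [sq_nonneg (f (1, 0)), sq_nonneg (f (0, 1))]
    obtain ⟨p, hp⟩ := hS
    obtain ⟨q, hq⟩ := hT
    have h3 := ha' p hp
    have h4 := hb' q hq
    rw [hf, h1, h2] at h3 h4
    linarith
  refine ⟨⟨f (1, 0), f (0, 1), -(a + b) / 2, 1, one_ne_zero, hnorm⟩, fun p hp => ?_,
    fun p hp => ?_⟩
  · have := ha' p hp
    rw [hf] at this
    simp only [Frame.side]
    linarith
  · have := hb' p hp
    rw [hf] at this
    simp only [Frame.side]
    linarith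

theorem collinear_of_area_eq_zero (F : Frame) {S : Set (ℝ × ℝ)} {p q : ℝ × ℝ} (hpq : p ≠ q)
    (h : ∀ w ∈ S, F.area p q w = 0) : Collinear ℝ S := by
  have hpos : 0 < (q.1 - p.1) ^ 2 + (q.2 - p.2) ^ 2 := by
    by_contra hcon
    have h1 : q.1 - p.1 = 0 := by nlinarith [sq_nonneg (q.1 - p.1), sq_nonneg (q.2 - p.2)]
    have h2 : q.2 - p.2 = 0 := by nlinarith [sq_nonneg (q.1 - p.1), sq_nonneg (q.2 - p.2)]
    exact hpq (Prod.ext (by linarith) (by linarith))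
  refine (collinear_iff_exists_forall_eq_smul_vadd (k := ℝ) S).2 ⟨p, q - p, fun w hw => ?_⟩
  have h0 : (q.1 - p.1) * (w.2 - p.2) - (q.2 - p.2) * (w.1 - p.1) = 0 :=
    (mul_eq_zero.1 (h w hw)).resolve_left F.e_ne
  refine ⟨((w.1 - p.1) * (q.1 - p.1) + (w.2 - p.2) * (q.2 - p.2)) /
    ((q.1 - p.1) ^ 2 + (q.2 - p.2) ^ 2), ?_⟩
  ext
  · simp only [vadd_eq_add, Prod.fst_add, Prod.smul_fst, Prod.fst_sub, smul_eq_mul]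
    field_simp
    linear_combination -(q.2 - p.2) * h0
  · simp only [vadd_eq_add, Prod.snd_add, Prod.smul_snd, Prod.snd_sub, smul_eq_mul]
    field_simp
    linear_combination (q.1 - p.1) * h0

end GeomGraph

/-- Let `G₁` and `G₂` be properly coloured non-crossing geometric graphs, each with at least
one edge, whose convex hulls are disjoint and whose vertices are not all collinear.
Then there are vertices `v₁` of `G₁` and `v₂` of `G₂` of different colours such that
the segment `v₁v₂` meets no vertex or edge of `G₁ ∪ G₂` except at its endpoints
(so that adding the edge `v₁v₂` again gives a properly coloured non-crossing geometric
graph). -/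
theorem bichromatic_noncrossing_connecting_edge
    {C : Type*} (G₁ G₂ : GeomGraph) (c : (ℝ × ℝ) → C)
    (hc1 : ProperlyColoured G₁ c) (hc2 : ProperlyColoured G₂ c)
    (hnc1 : GeomNonCrossing G₁) (hnc2 : GeomNonCrossing G₂)
    (he1 : ∃ x y, G₁.Adj x y) (he2 : ∃ x y, G₂.Adj x y)
    (hhull : Disjoint (convexHull ℝ (G₁.verts : Set (ℝ × ℝ)))
                      (convexHull ℝ (G₂.verts : Set (ℝ × ℝ))))
    (hncol : ¬ Collinear ℝ ((G₁.verts ∪ G₂.verts : Finset (ℝ × ℝ)) : Set (ℝ × ℝ))) :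
    ∃ v₁ ∈ G₁.verts, ∃ v₂ ∈ G₂.verts, c v₁ ≠ c v₂ ∧
      (∀ z ∈ G₁.verts ∪ G₂.verts, z ∈ segment ℝ v₁ v₂ → z = v₁ ∨ z = v₂) ∧
      (∀ x y, (G₁.Adj x y ∨ G₂.Adj x y) →
        ∀ p ∈ segment ℝ x y, p ∈ segment ℝ v₁ v₂ → p = v₁ ∨ p = v₂) := by
  obtain ⟨x₁, y₁, h₁⟩ := he1
  obtain ⟨x₂, y₂, h₂⟩ := he2
  obtain ⟨F, hF₁, hF₂⟩ := GeomGraph.exists_frame ⟨x₁, G₁.mem_verts_of_adj _ _ h₁⟩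
    ⟨x₂, G₂.mem_verts_of_adj _ _ h₂⟩ hhull
  have hS : GeomGraph.Separates F (G₁.union G₂) := by
    refine ⟨fun p hp => ?_, ?_, GeomGraph.union_nonCrossing hnc1 hnc2 hhull⟩
    · rcases Finset.mem_union.1 hp with hp | hp
      · exact (hF₁ p hp).ne
      · exact (hF₂ p hp).ne'
    · rintro p q (h | h)
      · exact mul_pos_of_neg_of_neg (hF₁ p (G₁.mem_verts_of_adj _ _ h))
          (hF₁ q (GeomGraph.mem_right_of_adj h))
      · exact mul_pos (hF₂ p (G₂.mem_verts_of_adj _ _ h))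
          (hF₂ q (GeomGraph.mem_right_of_adj h))
  have hnot := GeomGraph.not_isMonochromatic hS
    (fun x y h => h.elim (hc1 x y) (hc2 x y))
    ⟨x₁, y₁, Or.inl h₁, hF₁ x₁ (G₁.mem_verts_of_adj _ _ h₁)⟩
    ⟨x₂, y₂, Or.inr h₂, hF₂ x₂ (G₂.mem_verts_of_adj _ _ h₂)⟩ <| by
      intro p q hpq
      by_contra! hcon
      exact hncol (GeomGraph.collinear_of_area_eq_zero F hpq hcon)
  unfold GeomGraph.IsMonochromatic at hnot
  push Not at hnot
  obtain ⟨v₁, hv₁, v₂, hv₂, hs₁, hs₂, hsees, hne⟩ := hnot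
  refine ⟨v₁, ?_, v₂, ?_, hne, hsees.1, hsees.2⟩
  · exact (Finset.mem_union.1 hv₁).resolve_right fun h => (hF₂ v₁ h).not_gt hs₁
  · exact (Finset.mem_union.1 hv₂).resolve_left fun h => (hF₁ v₂ h).not_gt hs₂
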